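/- Let d, d' ≥ 1, n = (n₁,…,n_d), n' = (n'₁,…,n'_{d'}) with all entries ≥ 1, and F = ℝ or ℂ. For T ∈ F^{n₁×⋯×n_d} and T' ∈ F^{n'₁×⋯×n'_{d'}}, viewing T⊗T' as a (d+d')-mode tensor with entries (T⊗T')_{i₁…i_d,j₁…j_{d'}} = t_{i₁…i_d}·t'_{j₁…j_{d'}}, one has ‖T⊗T'‖_{∞,F} = ‖T‖_{∞,F}·‖T'‖_{∞,F} and ‖T⊗T'‖_{1,F} = ‖T‖_{1,F}·‖T'‖_{1,F}. -/

import Mathlib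

noncomputable section


/-- The Euclidean norm of a vector in `𝕜^k`. -/
def vnorm {𝕜 : Type*} [RCLike 𝕜] {k : ℕ} (x : Fin k → 𝕜) : ℝ :=
  Real.sqrt (∑ i, ‖x i‖ ^ 2)

/-- The rank-one tensor `x₁ ⊗ ⋯ ⊗ x_d`. -/
def rankOne {𝕜 : Type*} [RCLike 𝕜] {d : ℕ} {n : Fin d → ℕ}
    (x : ∀ j, Fin (n j) → 𝕜) : (∀ j, Fin (n j)) → 𝕜 :=
  fun i => ∏ j, x j (i j)

/-- The standard inner product `⟨T, Y⟩ = ∑ tᵢ · conj yᵢ` of tensors. -/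
def tinner {𝕜 : Type*} [RCLike 𝕜] {d : ℕ} {n : Fin d → ℕ}
    (T Y : (∀ j, Fin (n j)) → 𝕜) : 𝕜 :=
  ∑ i, T i * (starRingEnd 𝕜) (Y i)

/-- The Hilbert–Schmidt norm of a tensor. -/
def hsNorm {𝕜 : Type*} [RCLike 𝕜] {d : ℕ} {n : Fin d → ℕ}
    (T : (∀ j, Fin (n j)) → 𝕜) : ℝ :=
  Real.sqrt (∑ i, ‖T i‖ ^ 2)

/-- The spectral norm of a tensor:
`max {|⟨T, x₁⊗⋯⊗x_d⟩| : ‖x_j‖ = 1 for all j}`. -/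
def specNorm {𝕜 : Type*} [RCLike 𝕜] {d : ℕ} {n : Fin d → ℕ}
    (T : (∀ j, Fin (n j)) → 𝕜) : ℝ :=
  sSup {r : ℝ | ∃ x : ∀ j, Fin (n j) → 𝕜, (∀ j, vnorm (x j) = 1) ∧
    r = ‖tinner T (rankOne x)‖}

/-- The nuclear norm of a tensor:
`min {∑ᵢ ∏ⱼ ‖x_{i,j}‖ : T = ∑ᵢ x_{i,1}⊗⋯⊗x_{i,d}}`. -/
def nucNorm {𝕜 : Type*} [RCLike 𝕜] {d : ℕ} {n : Fin d → ℕ}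
    (T : (∀ j, Fin (n j)) → 𝕜) : ℝ :=
  sInf {r : ℝ | ∃ (m : ℕ) (x : Fin m → ∀ j, Fin (n j) → 𝕜),
    T = (∑ i, rankOne (x i)) ∧ r = ∑ i, ∏ j, vnorm (x i j)}

/-- `α(n, 𝕜)`: the maximal nuclear norm of a tensor of Hilbert–Schmidt norm one. -/
def alphaN (𝕜 : Type*) [RCLike 𝕜] (d : ℕ) (n : Fin d → ℕ) : ℝ :=
  sSup {r : ℝ | ∃ T : (∀ j, Fin (n j)) → 𝕜, hsNorm T = 1 ∧ r = nucNorm T}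

/-- `β(n, 𝕜)`: the minimal spectral norm of a tensor of Hilbert–Schmidt norm one. -/
def betaN (𝕜 : Type*) [RCLike 𝕜] (d : ℕ) (n : Fin d → ℕ) : ℝ :=
  sInf {r : ℝ | ∃ T : (∀ j, Fin (n j)) → 𝕜, hsNorm T = 1 ∧ r = specNorm T}

/-- The tensor (outer) product of a `d`-mode tensor and a `d'`-mode tensor, a
`(d+d')`-mode tensor with entries `(T ⊗ T')_{i,j} = t_i · t'_j`. -/
def tensProd {𝕜 : Type*} [RCLike 𝕜] {d d' : ℕ} {n : Fin d → ℕ} {n' : Fin d' → ℕ}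
    (T : (∀ j, Fin (n j)) → 𝕜) (T' : (∀ j, Fin (n' j)) → 𝕜) :
    (∀ j : Fin (d + d'), Fin (Fin.append n n' j)) → 𝕜 :=
  fun i => T (fun j => Fin.cast (Fin.append_left n n' j) (i (Fin.castAdd d' j))) *
    T' (fun j => Fin.cast (Fin.append_right n n' j) (i (Fin.natAdd d j)))


section helpers

variable {𝕜 : Type*} [RCLike 𝕜]

theorem vnorm_nonneg {k : ℕ} (x : Fin k → 𝕜) : 0 ≤ vnorm x := Real.sqrt_nonneg _

theorem vnorm_cast {k l : ℕ} (h : l = k) (x : Fin k → 𝕜) :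
    vnorm (fun i => x (Fin.cast h i)) = vnorm x := by
  subst h; rfl

theorem vnorm_smul {k : ℕ} (c : 𝕜) (x : Fin k → 𝕜) : vnorm (c • x) = ‖c‖ * vnorm x := by
  unfold vnorm
  simp only [Pi.smul_apply, smul_eq_mul, norm_mul, mul_pow, ← Finset.mul_sum]
  rw [Real.sqrt_mul (by positivity), Real.sqrt_sq (norm_nonneg _)]

theorem norm_le_vnorm {k : ℕ} (x : Fin k → 𝕜) (i : Fin k) : ‖x i‖ ≤ vnorm x := by
  unfold vnorm
  apply Real.le_sqrt_of_sq_le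
  exact Finset.single_le_sum (f := fun i => ‖x i‖ ^ 2) (fun _ _ => by positivity)
    (Finset.mem_univ i)

theorem vnorm_single {k : ℕ} (i : Fin k) : vnorm (Pi.single i 1 : Fin k → 𝕜) = 1 := by
  unfold vnorm
  rw [Finset.sum_eq_single i]
  · simp
  · intro b _ hb
    simp [Pi.single_eq_of_ne hb]
  · simp

variable {d d' : ℕ} {n : Fin d → ℕ} {n' : Fin d' → ℕ}

/-- splitting of multi-indices -/
def idxEquiv (n : Fin d → ℕ) (n' : Fin d' → ℕ) :
    (∀ j : Fin (d + d'), Fin (Fin.append n n' j)) ≃ (∀ j, Fin (n j)) × (∀ j, Fin (n' j)) where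
  toFun i := (fun j => Fin.cast (Fin.append_left n n' j) (i (Fin.castAdd d' j)),
    fun j => Fin.cast (Fin.append_right n n' j) (i (Fin.natAdd d j)))
  invFun p := fun j => Fin.addCases (motive := fun j => Fin (Fin.append n n' j))
    (fun j => Fin.cast (Fin.append_left n n' j).symm (p.1 j))
    (fun j => Fin.cast (Fin.append_right n n' j).symm (p.2 j)) j
  left_inv i := by
    funext j
    refine Fin.addCases (fun j => ?_) (fun j => ?_) j <;> simp
  right_inv p := by
    ext j <;> simp

theorem tensProd_apply (T : (∀ j, Fin (n j)) → 𝕜) (T' : (∀ j, Fin (n' j)) → 𝕜) (i) :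
    tensProd T T' i = T (idxEquiv n n' i).1 * T' (idxEquiv n n' i).2 := rfl

theorem tinner_tensProd (T S : (∀ j, Fin (n j)) → 𝕜) (T' S' : (∀ j, Fin (n' j)) → 𝕜) :
    tinner (tensProd T T') (tensProd S S') = tinner T S * tinner T' S' := by
  unfold tinner
  rw [Finset.sum_mul_sum, ← Fintype.sum_prod_type' (fun i j => T i * (starRingEnd 𝕜) (S i) *
      (T' j * (starRingEnd 𝕜) (S' j)))]
  refine Fintype.sum_equiv (idxEquiv n n') _ _ fun i => ?_
  simp only [tensProd_apply, map_mul]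
  ring

/-- joining of vector families -/
def joinV (x : ∀ j, Fin (n j) → 𝕜) (y : ∀ j, Fin (n' j) → 𝕜) :
    ∀ j : Fin (d + d'), Fin (Fin.append n n' j) → 𝕜 :=
  fun j => Fin.addCases (motive := fun j => Fin (Fin.append n n' j) → 𝕜)
    (fun j k => x j (Fin.cast (Fin.append_left n n' j) k))
    (fun j k => y j (Fin.cast (Fin.append_right n n' j) k)) j

theorem joinV_left (x : ∀ j, Fin (n j) → 𝕜) (y : ∀ j, Fin (n' j) → 𝕜) (j : Fin d) :
    joinV x y (Fin.castAdd d' j) = fun k => x j (Fin.cast (Fin.append_left n n' j) k) := by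
  simp [joinV]

theorem joinV_right (x : ∀ j, Fin (n j) → 𝕜) (y : ∀ j, Fin (n' j) → 𝕜) (j : Fin d') :
    joinV x y (Fin.natAdd d j) = fun k => y j (Fin.cast (Fin.append_right n n' j) k) := by
  simp [joinV]

theorem exists_joinV (z : ∀ j : Fin (d + d'), Fin (Fin.append n n' j) → 𝕜) :
    ∃ (x : ∀ j, Fin (n j) → 𝕜) (y : ∀ j, Fin (n' j) → 𝕜), z = joinV x y := by
  refine ⟨fun j k => z (Fin.castAdd d' j) (Fin.cast (Fin.append_left n n' j).symm k),
    fun j k => z (Fin.natAdd d j) (Fin.cast (Fin.append_right n n' j).symm k), ?_⟩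
  funext j
  refine Fin.addCases (fun j => ?_) (fun j => ?_) j
  · rw [joinV_left]; simp
  · rw [joinV_right]; simp

theorem rankOne_joinV (x : ∀ j, Fin (n j) → 𝕜) (y : ∀ j, Fin (n' j) → 𝕜) :
    rankOne (joinV x y) = tensProd (rankOne x) (rankOne y) := by
  funext i
  unfold rankOne tensProd
  rw [Fin.prod_univ_add]
  simp only [joinV_left, joinV_right]

theorem vnorm_joinV_left (x : ∀ j, Fin (n j) → 𝕜) (y : ∀ j, Fin (n' j) → 𝕜) (j : Fin d) :
    vnorm (joinV x y (Fin.castAdd d' j)) = vnorm (x j) := by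
  rw [joinV_left, vnorm_cast]

theorem vnorm_joinV_right (x : ∀ j, Fin (n j) → 𝕜) (y : ∀ j, Fin (n' j) → 𝕜) (j : Fin d') :
    vnorm (joinV x y (Fin.natAdd d j)) = vnorm (y j) := by
  rw [joinV_right, vnorm_cast]

theorem prod_vnorm_joinV (x : ∀ j, Fin (n j) → 𝕜) (y : ∀ j, Fin (n' j) → 𝕜) :
    ∏ j, vnorm (joinV x y j) = (∏ j, vnorm (x j)) * ∏ j, vnorm (y j) := by
  rw [Fin.prod_univ_add]
  simp only [vnorm_joinV_left, vnorm_joinV_right]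

/-! Spectral norm -/

theorem spec_bdd (T : (∀ j, Fin (n j)) → 𝕜) :
    BddAbove {r : ℝ | ∃ x : ∀ j, Fin (n j) → 𝕜, (∀ j, vnorm (x j) = 1) ∧
    r = ‖tinner T (rankOne x)‖} := by
  refine ⟨∑ i, ‖T i‖, ?_⟩
  rintro r ⟨x, hx, rfl⟩
  unfold tinner
  refine (norm_sum_le _ _).trans (Finset.sum_le_sum fun i _ => ?_)
  rw [norm_mul, RCLike.norm_conj]
  refine mul_le_of_le_one_right (norm_nonneg _) ?_
  unfold rankOne
  rw [norm_prod]
  exact Finset.prod_le_one (fun _ _ => norm_nonneg _) fun j _ =>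
    (norm_le_vnorm _ _).trans (hx j).le

theorem le_spec (T : (∀ j, Fin (n j)) → 𝕜) (x : ∀ j, Fin (n j) → 𝕜)
    (hx : ∀ j, vnorm (x j) = 1) : ‖tinner T (rankOne x)‖ ≤ specNorm T :=
  le_csSup (spec_bdd T) ⟨x, hx, rfl⟩

theorem spec_nonneg (T : (∀ j, Fin (n j)) → 𝕜) : 0 ≤ specNorm T := by
  apply Real.sSup_nonneg
  rintro r ⟨x, hx, rfl⟩
  exact norm_nonneg _

theorem spec_nonempty (hn : ∀ j, 1 ≤ n j) (T : (∀ j, Fin (n j)) → 𝕜) :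
    {r : ℝ | ∃ x : ∀ j, Fin (n j) → 𝕜, (∀ j, vnorm (x j) = 1) ∧
    r = ‖tinner T (rankOne x)‖}.Nonempty :=
  ⟨_, fun j => Pi.single ⟨0, hn j⟩ 1, fun _ => vnorm_single _, rfl⟩

theorem spec_exists (hn : ∀ j, 1 ≤ n j) (T : (∀ j, Fin (n j)) → 𝕜) {b : ℝ}
    (h : ∀ x : ∀ j, Fin (n j) → 𝕜, (∀ j, vnorm (x j) = 1) → ‖tinner T (rankOne x)‖ ≤ b) :
    specNorm T ≤ b := by
  refine csSup_le (spec_nonempty hn T) ?_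
  rintro r ⟨x, hx, rfl⟩
  exact h x hx

theorem spec_mul (hn : ∀ j, 1 ≤ n j) (hn' : ∀ j, 1 ≤ n' j)
    (T : (∀ j, Fin (n j)) → 𝕜) (T' : (∀ j, Fin (n' j)) → 𝕜) :
    specNorm (tensProd T T') = specNorm T * specNorm T' := by
  apply le_antisymm
  · refine spec_exists (fun j => ?_) _ fun z hz => ?_
    · refine Fin.addCases (fun j => ?_) (fun j => ?_) j
      · rw [Fin.append_left]; exact hn j
      · rw [Fin.append_right]; exact hn' j
    · obtain ⟨x, y, rfl⟩ := exists_joinV z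
      rw [rankOne_joinV, tinner_tensProd, norm_mul]
      refine mul_le_mul (le_spec T x fun j => ?_) (le_spec T' y fun j => ?_) (norm_nonneg _)
        (spec_nonneg T)
      · rw [← vnorm_joinV_left x y, hz]
      · rw [← vnorm_joinV_right x y, hz]
  · have key : ∀ x : ∀ j, Fin (n j) → 𝕜, (∀ j, vnorm (x j) = 1) →
        ∀ y : ∀ j, Fin (n' j) → 𝕜, (∀ j, vnorm (y j) = 1) →
        ‖tinner T (rankOne x)‖ * ‖tinner T' (rankOne y)‖ ≤ specNorm (tensProd T T') := by
      intro x hx y hy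
      rw [← norm_mul, ← tinner_tensProd, ← rankOne_joinV]
      refine le_spec _ _ fun j => ?_
      refine Fin.addCases (fun j => ?_) (fun j => ?_) j
      · rw [vnorm_joinV_left, hx]
      · rw [vnorm_joinV_right, hy]
    have h0 := spec_nonneg (tensProd T T')
    have k2 : ∀ y : ∀ j, Fin (n' j) → 𝕜, (∀ j, vnorm (y j) = 1) →
        specNorm T * ‖tinner T' (rankOne y)‖ ≤ specNorm (tensProd T T') := by
      intro y hy
      rcases (norm_nonneg (tinner T' (rankOne y))).eq_or_lt with h | h
      · rw [← h, mul_zero]; exact h0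
      · rw [← le_div_iff₀ h]
        exact spec_exists hn T fun x hx => (le_div_iff₀ h).2 (key x hx y hy)
    rcases (spec_nonneg T).eq_or_lt with h | h
    · rw [← h, zero_mul]; exact h0
    · rw [← le_div_iff₀' h]
      exact spec_exists hn' T' fun y hy => (le_div_iff₀' h).2 (k2 y hy)

/-! Nuclear norm -/

theorem nuc_bdd (T : (∀ j, Fin (n j)) → 𝕜) :
    BddBelow {r : ℝ | ∃ (m : ℕ) (x : Fin m → ∀ j, Fin (n j) → 𝕜),
    T = (∑ i, rankOne (x i)) ∧ r = ∑ i, ∏ j, vnorm (x i j)} := by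
  refine ⟨0, ?_⟩
  rintro r ⟨m, x, -, rfl⟩
  exact Finset.sum_nonneg fun _ _ => Finset.prod_nonneg fun _ _ => vnorm_nonneg _

theorem nuc_nonneg (T : (∀ j, Fin (n j)) → 𝕜) : 0 ≤ nucNorm T := by
  apply Real.sInf_nonneg
  rintro r ⟨m, x, -, rfl⟩
  exact Finset.sum_nonneg fun _ _ => Finset.prod_nonneg fun _ _ => vnorm_nonneg _

theorem nuc_le {ι : Type*} [Fintype ι] (T : (∀ j, Fin (n j)) → 𝕜)
    (x : ι → ∀ j, Fin (n j) → 𝕜) (h : T = ∑ i, rankOne (x i)) :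
    nucNorm T ≤ ∑ i, ∏ j, vnorm (x i j) := by
  refine csInf_le (nuc_bdd T) ⟨Fintype.card ι, fun k => x ((Fintype.equivFin ι).symm k), ?_, ?_⟩
  · rw [h]
    exact (Equiv.sum_comp (Fintype.equivFin ι).symm (fun i => rankOne (x i))).symm
  · exact (Equiv.sum_comp (Fintype.equivFin ι).symm (fun i => ∏ j, vnorm (x i j))).symm

theorem exists_scale (hd : 1 ≤ d) (c : 𝕜) (x : ∀ j, Fin (n j) → 𝕜) :
    ∃ y : ∀ j, Fin (n j) → 𝕜, rankOne y = c • rankOne x ∧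
      ∏ j, vnorm (y j) = ‖c‖ * ∏ j, vnorm (x j) := by
  obtain ⟨e, rfl⟩ : ∃ e, d = e + 1 := ⟨d - 1, by omega⟩
  refine ⟨fun j => (if j = 0 then c else 1) • x j, ?_, ?_⟩
  · funext i
    simp only [rankOne, Pi.smul_apply, smul_eq_mul, Finset.prod_mul_distrib]
    simp
  · simp only [vnorm_smul, Finset.prod_mul_distrib, apply_ite norm, norm_one]
    simp

theorem nuc_nonempty (hd : 1 ≤ d) (T : (∀ j, Fin (n j)) → 𝕜) :
    {r : ℝ | ∃ (m : ℕ) (x : Fin m → ∀ j, Fin (n j) → 𝕜),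
    T = (∑ i, rankOne (x i)) ∧ r = ∑ i, ∏ j, vnorm (x i j)}.Nonempty := by
  choose y hy _ using fun a : (∀ j, Fin (n j)) =>
    exists_scale (n := n) hd (T a) (fun j => Pi.single (a j) 1)
  let e := (Fintype.equivFin (∀ j, Fin (n j))).symm
  refine ⟨_, _, fun k => y (e k), ?_, rfl⟩
  rw [Equiv.sum_comp e (fun a => rankOne (y a))]
  funext b
  simp only [hy, Finset.sum_apply, Pi.smul_apply, smul_eq_mul, rankOne]
  rw [Finset.sum_eq_single b]
  · simp
  · intro a _ hab
    obtain ⟨j, hj⟩ := Function.ne_iff.1 hab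
    rw [Finset.prod_eq_zero (Finset.mem_univ j), mul_zero]
    exact Pi.single_eq_of_ne hj.symm _
  · simp

theorem nuc_exists (hd : 1 ≤ d) (T : (∀ j, Fin (n j)) → 𝕜) {ε : ℝ} (hε : 0 < ε) :
    ∃ (m : ℕ) (x : Fin m → ∀ j, Fin (n j) → 𝕜),
    T = (∑ i, rankOne (x i)) ∧ ∑ i, ∏ j, vnorm (x i j) < nucNorm T + ε := by
  obtain ⟨r, ⟨m, x, h, rfl⟩, hr⟩ := Real.lt_sInf_add_pos (nuc_nonempty hd T) hε
  exact ⟨m, x, h, hr⟩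

theorem nuc_add (hd : 1 ≤ d) (S T : (∀ j, Fin (n j)) → 𝕜) :
    nucNorm (S + T) ≤ nucNorm S + nucNorm T := by
  refine le_of_forall_pos_le_add fun ε hε => ?_
  obtain ⟨m, x, h, hr⟩ := nuc_exists hd S (half_pos hε)
  obtain ⟨m', x', h', hr'⟩ := nuc_exists hd T (half_pos hε)
  have := nuc_le (S + T) (Sum.elim x x') (by simp [← h, ← h'])
  simp at this
  linarith

theorem nuc_smul (hd : 1 ≤ d) (c : 𝕜) (T : (∀ j, Fin (n j)) → 𝕜) :
    nucNorm (c • T) ≤ ‖c‖ * nucNorm T := by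
  have key : ∀ ε > 0, nucNorm (c • T) ≤ ‖c‖ * (nucNorm T + ε) := by
    intro ε hε
    obtain ⟨m, x, h, hr⟩ := nuc_exists hd T hε
    choose y hy hy' using fun i => exists_scale hd c (x i)
    refine (nuc_le (c • T) y ?_).trans ?_
    · simp only [hy, ← Finset.smul_sum, ← h]
    · simp only [hy', ← Finset.mul_sum]
      exact mul_le_mul_of_nonneg_left hr.le (norm_nonneg _)
  refine le_of_forall_pos_le_add fun ε hε => ?_
  have h1 : 0 < ‖c‖ + 1 := by positivity
  refine (key (ε / (‖c‖ + 1)) (by positivity)).trans ?_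
  rw [mul_add]
  gcongr
  rw [mul_div_assoc', div_le_iff₀ h1]
  nlinarith

/-- the nuclear norm as a seminorm -/
def nucSemi (𝕜 : Type*) [RCLike 𝕜] (hd : 1 ≤ d) (n : Fin d → ℕ) :
    Seminorm 𝕜 ((∀ j, Fin (n j)) → 𝕜) :=
  Seminorm.ofSMulLE nucNorm
    (le_antisymm (by simpa using nuc_le (0 : (∀ j, Fin (n j)) → 𝕜) (fun i : Fin 0 => i.elim0) (by simp))
      (nuc_nonneg _))
    (nuc_add hd) (nuc_smul hd)

theorem seminorm_dual {E : Type*} [AddCommGroup E] [Module 𝕜 E] (p : Seminorm 𝕜 E) (x : E) :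
    ∃ g : E →ₗ[𝕜] 𝕜, g x = (p x : 𝕜) ∧ ∀ y, ‖g y‖ ≤ p y := by
  let : SeminormedAddCommGroup E := p.toAddGroupSeminorm.toSeminormedAddCommGroup
  let : NormedSpace 𝕜 E := ⟨fun c y => (map_smul_eq_mul p c y).le⟩
  obtain ⟨g, hg, hx⟩ := exists_dual_vector'' 𝕜 x
  refine ⟨g.toLinearMap, hx, fun y => ?_⟩
  exact (g.le_of_opNorm_le hg y).trans (one_mul ‖y‖).le

theorem nuc_rankOne (x : ∀ j, Fin (n j) → 𝕜) : nucNorm (rankOne x) ≤ ∏ j, vnorm (x j) := by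
  simpa using nuc_le (rankOne x) (fun _ : Unit => x) (by simp)

theorem nuc_mul_le (hd : 1 ≤ d) (hd' : 1 ≤ d')
    (T : (∀ j, Fin (n j)) → 𝕜) (T' : (∀ j, Fin (n' j)) → 𝕜) :
    nucNorm (tensProd T T') ≤ nucNorm T * nucNorm T' := by
  have key : ∀ ε > 0, nucNorm (tensProd T T') ≤ (nucNorm T + ε) * (nucNorm T' + ε) := by
    intro ε hε
    obtain ⟨m, x, h, hr⟩ := nuc_exists hd T hε
    obtain ⟨m', y, h', hr'⟩ := nuc_exists hd' T' hε
    refine (nuc_le (tensProd T T') (fun p : Fin m × Fin m' => joinV (x p.1) (y p.2)) ?_).trans ?_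
    · funext i
      simp only [rankOne_joinV, Finset.sum_apply, tensProd_apply, Fintype.sum_prod_type]
      rw [← Finset.sum_mul_sum]
      conv_lhs => rw [h, h']
      simp only [Finset.sum_apply]
    · simp only [prod_vnorm_joinV, Fintype.sum_prod_type]
      rw [← Finset.sum_mul_sum]
      refine mul_le_mul hr.le hr'.le ?_ ?_
      · exact Finset.sum_nonneg fun _ _ => Finset.prod_nonneg fun _ _ => vnorm_nonneg _
      · have := nuc_nonneg T
        positivity
  have ht : Filter.Tendsto (fun ε : ℝ => (nucNorm T + ε) * (nucNorm T' + ε))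
      (nhdsWithin 0 (Set.Ioi 0)) (nhds (nucNorm T * nucNorm T')) := by
    have : Continuous (fun ε : ℝ => (nucNorm T + ε) * (nucNorm T' + ε)) := by fun_prop
    have h2 := this.tendsto 0
    simp only [add_zero] at h2
    exact h2.mono_left nhdsWithin_le_nhds
  refine ge_of_tendsto ht ?_
  filter_upwards [self_mem_nhdsWithin] with ε hε using key ε hε

theorem nuc_le_mul (hd : 1 ≤ d) (hd' : 1 ≤ d')
    (T : (∀ j, Fin (n j)) → 𝕜) (T' : (∀ j, Fin (n' j)) → 𝕜) :
    nucNorm T * nucNorm T' ≤ nucNorm (tensProd T T') := by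
  obtain ⟨g, hg, hle⟩ := seminorm_dual (nucSemi 𝕜 hd' n') T'
  refine le_csInf (nuc_nonempty (by omega) _) ?_
  rintro r ⟨m, z, hz, rfl⟩
  choose x y hxy using fun i => exists_joinV (z i)
  simp only [hxy, prod_vnorm_joinV]
  simp only [hxy, rankOne_joinV] at hz
  have h1 : ∀ a, T a • T' = ∑ i, rankOne (x i) a • rankOne (y i) := by
    intro a
    funext b
    have := congrFun hz ((idxEquiv n n').symm (a, b))
    simpa [tensProd_apply] using this
  have h2 : g T' • T = ∑ i, g (rankOne (y i)) • rankOne (x i) := by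
    funext a
    have := congrArg g (h1 a)
    simp only [map_smul, map_sum, smul_eq_mul] at this
    simp only [Pi.smul_apply, Finset.sum_apply, smul_eq_mul]
    rw [mul_comm, this]
    exact Finset.sum_congr rfl fun i _ => mul_comm _ _
  have h3 := congrArg (nucSemi 𝕜 hd n) h2
  rw [map_smul_eq_mul, hg] at h3
  have h4 : ‖((nucSemi 𝕜 hd' n' T' : ℝ) : 𝕜)‖ = nucNorm T' := by
    rw [RCLike.norm_ofReal, abs_of_nonneg (apply_nonneg _ _)]
    rfl
  rw [h4] at h3
  calc nucNorm T * nucNorm T' = nucNorm T' * nucSemi 𝕜 hd n T := mul_comm _ _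
    _ = _ := h3
    _ ≤ ∑ i, nucSemi 𝕜 hd n (g (rankOne (y i)) • rankOne (x i)) := Finset.le_sum_of_subadditive _
        (map_zero _).le (map_add_le_add _) _ _
    _ ≤ _ := by
      refine Finset.sum_le_sum fun i _ => ?_
      rw [map_smul_eq_mul, mul_comm]
      exact mul_le_mul (nuc_rankOne (x i)) ((hle _).trans (nuc_rankOne (y i))) (norm_nonneg _)
        (Finset.prod_nonneg fun _ _ => vnorm_nonneg _)

end helpers

/-- Spectral and nuclear norms are multiplicative with respect to the
tensor product of tensors. -/
theorem stmt4 (𝕜 : Type*) [RCLike 𝕜] (d d' : ℕ) (hd : 1 ≤ d) (hd' : 1 ≤ d')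
    (n : Fin d → ℕ) (n' : Fin d' → ℕ) (hn : ∀ j, 1 ≤ n j) (hn' : ∀ j, 1 ≤ n' j)
    (T : (∀ j, Fin (n j)) → 𝕜) (T' : (∀ j, Fin (n' j)) → 𝕜) :
    specNorm (tensProd T T') = specNorm T * specNorm T' ∧
    nucNorm (tensProd T T') = nucNorm T * nucNorm T' := by
  exact ⟨spec_mul hn hn' T T', le_antisymm (nuc_mul_le hd hd' T T') (nuc_le_mul hd hd' T T')⟩
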